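/- Let N ≥ 2, N_f ≥ 1, K ≥ 1 be integers, let p ∈ ℂ with 0 < |p| < 1, let q, U ∈ ℂ ∖ {0}, let z₁, …, z_N ∈ ℂ ∖ {0} with z₁⋯z_N = 1, and let s₁, …, s_{N_f}, t₁, …, t_{N_f} ∈ ℂ ∖ {0} satisfy the balancing condition U^{2N} (∏_{i=1}^{N_f} s_i) (∏_{i=1}^{N_f} t_i)^{−1} = (pq)^{N_f}. For 1 ≤ a ≤ N−1 define h_a = [∏_{j=1, j≠a}^{N−1} θ(U z_a z_j^{−1};p) θ(U z_j z_N^{−1};p) θ(q^{−1} z_a^{−1} z_j;p) θ(q^{−1} z_j^{−1} z_N;p) / (θ(U q^{−1} z_a^{−1} z_j;p) θ(U q^{−1} z_j^{−1} z_N;p) θ(z_a z_j^{−1};p) θ(z_j z_N^{−1};p))] · [θ(U q z_a z_N^{−1};p) θ(U z_a z_N^{−1};p) θ(q^{−2} z_a^{−1} z_N;p) θ(q^{−1} z_a^{−1} z_N;p) / (θ(U q^{−1} z_a^{−1} z_N;p) θ(U q^{−2} z_a^{−1} z_N;p) θ(q z_a z_N^{−1};p) θ(z_a z_N^{−1};p))]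 · ∏_{i=1}^{N_f} [θ(s_i z_a;p) θ(t_i^{−1} z_N^{−1};p) / (θ(q^{−1} s_i z_N;p) θ(q^{−1} t_i^{−1} z_a^{−1};p))]. Then, wherever all theta factors in denominators are nonzero, h_a is unchanged under each of the following substitutions (each of which preserves the constraints): (i) (z_b, z_N) → (p z_b, p^{−1} z_N) for any 1 ≤ b ≤ N−1; (ii) (s_b, s_{N_f}) → (p s_b, p^{−1} s_{N_f}) for any 1 ≤ b < N_f; (iii) (t_b, t_{N_f}) → (p t_b, p^{−1} t_{N_f}) for any 1 ≤ b < N_f; (iv) (q, U, t_{N_f}) → (p^{K+1} q, p U, p^{2N−(K+1)N_f} t_{N_f}). -/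

import Mathlib

open scoped BigOperators

/-- The infinite q-Pochhammer symbol `(x;p)_∞ = ∏_{j≥0} (1 - x p^j)`. -/
noncomputable def pochInf (x p : ℂ) : ℂ := ∏' j : ℕ, (1 - x * p ^ j)

/-- The theta function `θ(x;p) = (x;p)_∞ (p x⁻¹;p)_∞`. -/
noncomputable def theta (x p : ℂ) : ℂ := pochInf x p * pochInf (p * x⁻¹) p

/-- The `q`-certificate `h_a` (in the variable `z_a`, `1 ≤ a ≤ N-1`) of the ratio
of the electric and magnetic Kutasov–Schwimmer superconformal index kernels for
`SU(N)` with an adjoint.  Here `N = n+1`, `N_f = f+1`, the last variable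
`z (Fin.last n)` plays the role of `z_N`, and `a : Fin n` indexes `z_a` via
`Fin.castSucc`. -/
noncomputable def ksCert (n f : ℕ) (p q U : ℂ) (z : Fin (n + 1) → ℂ)
    (s t : Fin (f + 1) → ℂ) (a : Fin n) : ℂ :=
  (∏ j ∈ Finset.univ.filter (fun j : Fin n => j ≠ a),
      theta (U * z a.castSucc * (z j.castSucc)⁻¹) p *
        theta (U * z j.castSucc * (z (Fin.last n))⁻¹) p *
        theta (q⁻¹ * (z a.castSucc)⁻¹ * z j.castSucc) p *
        theta (q⁻¹ * (z j.castSucc)⁻¹ * z (Fin.last n)) p /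
      (theta (U * q⁻¹ * (z a.castSucc)⁻¹ * z j.castSucc) p *
        theta (U * q⁻¹ * (z j.castSucc)⁻¹ * z (Fin.last n)) p *
        theta (z a.castSucc * (z j.castSucc)⁻¹) p *
        theta (z j.castSucc * (z (Fin.last n))⁻¹) p)) *
  (theta (U * q * z a.castSucc * (z (Fin.last n))⁻¹) p *
      theta (U * z a.castSucc * (z (Fin.last n))⁻¹) p *
      theta (q⁻¹ ^ 2 * (z a.castSucc)⁻¹ * z (Fin.last n)) p *
      theta (q⁻¹ * (z a.castSucc)⁻¹ * z (Fin.last n)) p /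
    (theta (U * q⁻¹ * (z a.castSucc)⁻¹ * z (Fin.last n)) p *
      theta (U * q⁻¹ ^ 2 * (z a.castSucc)⁻¹ * z (Fin.last n)) p *
      theta (q * z a.castSucc * (z (Fin.last n))⁻¹) p *
      theta (z a.castSucc * (z (Fin.last n))⁻¹) p)) *
  ∏ i, theta (s i * z a.castSucc) p * theta ((t i)⁻¹ * (z (Fin.last n))⁻¹) p /
      (theta (q⁻¹ * s i * z (Fin.last n)) p * theta (q⁻¹ * (t i)⁻¹ * (z a.castSucc)⁻¹) p)

/-- The product of all theta factors occurring in the denominators of `ksCert`;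
its nonvanishing is equivalent to the nonvanishing of every denominator theta
factor. -/
noncomputable def ksDen (n f : ℕ) (p q U : ℂ) (z : Fin (n + 1) → ℂ)
    (s t : Fin (f + 1) → ℂ) (a : Fin n) : ℂ :=
  (∏ j ∈ Finset.univ.filter (fun j : Fin n => j ≠ a),
      theta (U * q⁻¹ * (z a.castSucc)⁻¹ * z j.castSucc) p *
        theta (U * q⁻¹ * (z j.castSucc)⁻¹ * z (Fin.last n)) p *
        theta (z a.castSucc * (z j.castSucc)⁻¹) p *
        theta (z j.castSucc * (z (Fin.last n))⁻¹) p) *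
  (theta (U * q⁻¹ * (z a.castSucc)⁻¹ * z (Fin.last n)) p *
    theta (U * q⁻¹ ^ 2 * (z a.castSucc)⁻¹ * z (Fin.last n)) p *
    theta (q * z a.castSucc * (z (Fin.last n))⁻¹) p *
    theta (z a.castSucc * (z (Fin.last n))⁻¹) p) *
  ∏ i, theta (q⁻¹ * s i * z (Fin.last n)) p * theta (q⁻¹ * (t i)⁻¹ * (z a.castSucc)⁻¹) p

lemma pochInf_step (x p : ℂ) (hp1 : ‖p‖ < 1) : pochInf x p = (1 - x) * pochInf (p * x) p := by
  have hm : ∀ y : ℂ, Multipliable (fun j : ℕ => 1 - y * p ^ j) := by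
    intro y
    have := multipliable_one_add_of_summable (R := ℂ) (f := fun j : ℕ => -(y * p ^ j)) (by
      simp only [norm_neg, norm_mul, norm_pow]
      exact (summable_geometric_of_lt_one (norm_nonneg _) hp1).mul_left _)
    simpa [sub_eq_add_neg] using this
  unfold pochInf
  rw [tprod_eq_zero_mul']
  · simp only [pow_zero, mul_one]
    congr 1
    apply tprod_congr
    intro j
    ring
  · have := hm (p * x)
    refine this.congr ?_
    intro j
    ring

lemma theta_step (x p : ℂ) (hp0 : p ≠ 0) (hp1 : ‖p‖ < 1) (hx : x ≠ 0) :
    theta (p * x) p = -x⁻¹ * theta x p := by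
  unfold theta
  have h1 := pochInf_step x p hp1
  have h2 := pochInf_step x⁻¹ p hp1
  have h3 : p * (p * x)⁻¹ = x⁻¹ := by field_simp
  rw [h3, h1, h2]
  field_simp
  ring

lemma theta_shift (P x : ℂ) (hP : ‖Complex.exp P‖ < 1) (k : ℤ) :
    theta (-Complex.exp (x + k * P)) (Complex.exp P) =
      Complex.exp (-k * x - k * (k - 1) / 2 * P) * theta (-Complex.exp x) (Complex.exp P) := by
  have step : ∀ y : ℂ, theta (-Complex.exp (y + P)) (Complex.exp P) =
      Complex.exp (-y) * theta (-Complex.exp y) (Complex.exp P) := by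
    intro y
    have := theta_step (-Complex.exp y) (Complex.exp P) (Complex.exp_ne_zero _) hP
      (neg_ne_zero.mpr (Complex.exp_ne_zero _))
    rw [Complex.exp_add, Complex.exp_neg]
    rw [show -(Complex.exp y * Complex.exp P) = Complex.exp P * -Complex.exp y by ring, this,
      inv_neg, neg_neg]
  induction k using Int.induction_on with
  | zero => simp
  | succ i ih =>
    have := step (x + i * P)
    push_cast at ih ⊢
    rw [show x + (i + 1) * P = x + i * P + P by ring, this, ih, ← mul_assoc, ← Complex.exp_add]
    congr 2
    ring
  | pred i ih =>
    have := step (x + (-i - 1) * P)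
    push_cast at ih ⊢
    rw [show x + (-i - 1) * P + P = x + -i * P by ring, ih] at this
    have h2 : theta (-Complex.exp (x + (-i - 1) * P)) (Complex.exp P) =
      Complex.exp (x + (-i - 1) * P) * (Complex.exp (-(x + (-i - 1) * P)) *
        theta (-Complex.exp (x + (-i - 1) * P)) (Complex.exp P)) := by
      rw [← mul_assoc, ← Complex.exp_add]; simp
    rw [h2, ← this, ← mul_assoc, ← Complex.exp_add]
    congr 2
    ring

lemma theta_shift' (P x x' y y' : ℂ) (hP : ‖Complex.exp P‖ < 1) (k : ℤ)
    (hy : y = -Complex.exp x) (hy' : y' = -Complex.exp x') (hx : x' = x + k * P) :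
    theta y' (Complex.exp P) =
      Complex.exp (-k * x - k * (k - 1) / 2 * P) * theta y (Complex.exp P) := by
  rw [hy, hy', hx, theta_shift P x hP k]

lemma quot8 {E1 E2 E3 E4 E5 E6 E7 E8 E a1 a2 a3 a4 a5 a6 a7 a8 b1 b2 b3 b4 b5 b6 b7 b8 : ℂ}
    (h1 : b1 = Complex.exp E1 * a1) (h2 : b2 = Complex.exp E2 * a2)
    (h3 : b3 = Complex.exp E3 * a3) (h4 : b4 = Complex.exp E4 * a4)
    (h5 : b5 = Complex.exp E5 * a5) (h6 : b6 = Complex.exp E6 * a6)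
    (h7 : b7 = Complex.exp E7 * a7) (h8 : b8 = Complex.exp E8 * a8)
    (hE : E = E1 + E2 + E3 + E4 - (E5 + E6 + E7 + E8)) :
    b1 * b2 * b3 * b4 / (b5 * b6 * b7 * b8) =
      Complex.exp E * (a1 * a2 * a3 * a4 / (a5 * a6 * a7 * a8)) := by
  subst hE h1 h2 h3 h4 h5 h6 h7 h8
  simp only [Complex.exp_add, Complex.exp_sub, div_eq_mul_inv, mul_inv]
  ring

lemma quot4 {E1 E2 E5 E6 E a1 a2 a5 a6 b1 b2 b5 b6 : ℂ}
    (h1 : b1 = Complex.exp E1 * a1) (h2 : b2 = Complex.exp E2 * a2)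
    (h5 : b5 = Complex.exp E5 * a5) (h6 : b6 = Complex.exp E6 * a6)
    (hE : E = E1 + E2 - (E5 + E6)) :
    b1 * b2 / (b5 * b6) = Complex.exp E * (a1 * a2 / (a5 * a6)) := by
  subst hE h1 h2 h5 h6
  simp only [Complex.exp_add, Complex.exp_sub, div_eq_mul_inv, mul_inv]
  ring

lemma exp_neg_shift (x : ℂ) : Complex.exp x = -Complex.exp (x - Real.pi * Complex.I) := by
  rw [Complex.exp_sub, Complex.exp_pi_mul_I, div_neg, div_one, neg_neg]


lemma theta_shiftE (P x y y' : ℂ) (hP : ‖Complex.exp P‖ < 1) (k : ℤ)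
    (hy : y = Complex.exp x) (hy' : y' = Complex.exp (x + k * P)) :
    theta y' (Complex.exp P) =
      Complex.exp (-k * (x - Real.pi * Complex.I) - k * (k - 1) / 2 * P) *
        theta y (Complex.exp P) := by
  rw [hy, hy', exp_neg_shift, exp_neg_shift x, ← theta_shift P _ hP k]
  congr 3
  ring

lemma theta_shiftN (P x y y' : ℂ) (hP : ‖Complex.exp P‖ < 1) (k : ℤ)
    (hy : -y = Complex.exp x) (hy' : -y' = Complex.exp (x + k * P)) :
    theta y' (Complex.exp P) =
      Complex.exp (-k * x - k * (k - 1) / 2 * P) * theta y (Complex.exp P) := by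
  rw [← neg_neg y, ← neg_neg y', hy, hy', theta_shift P _ hP k]

lemma fac_j (P u q a j l : ℂ) (hP : ‖Complex.exp P‖ < 1) (ku kq ka kj kl : ℤ) :
    theta (Complex.exp (u + ku * P) * Complex.exp (a + ka * P) * (Complex.exp (j + kj * P))⁻¹) (Complex.exp P) * theta (Complex.exp (u + ku * P) * Complex.exp (j + kj * P) * (Complex.exp (l + kl * P))⁻¹) (Complex.exp P) * theta ((Complex.exp (q + kq * P))⁻¹ * (Complex.exp (a + ka * P))⁻¹ * Complex.exp (j + kj * P)) (Complex.exp P) * theta ((Complex.exp (q + kq * P))⁻¹ * (Complex.exp (j + kj * P))⁻¹ * Complex.exp (l + kl * P)) (Complex.exp P) /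
      (theta (Complex.exp (u + ku * P) * (Complex.exp (q + kq * P))⁻¹ * (Complex.exp (a + ka * P))⁻¹ * Complex.exp (j + kj * P)) (Complex.exp P) * theta (Complex.exp (u + ku * P) * (Complex.exp (q + kq * P))⁻¹ * (Complex.exp (j + kj * P))⁻¹ * Complex.exp (l + kl * P)) (Complex.exp P) * theta (Complex.exp (a + ka * P) * (Complex.exp (j + kj * P))⁻¹) (Complex.exp P) * theta (Complex.exp (j + kj * P) * (Complex.exp (l + kl * P))⁻¹) (Complex.exp P)) =
    Complex.exp (-2 * ((kq + ka - kl) * u + (q + a - l) * ku + (kq + ka - kl) * ku * P)) *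
      (theta (Complex.exp u * Complex.exp a * (Complex.exp j)⁻¹) (Complex.exp P) * theta (Complex.exp u * Complex.exp j * (Complex.exp l)⁻¹) (Complex.exp P) * theta ((Complex.exp q)⁻¹ * (Complex.exp a)⁻¹ * Complex.exp j) (Complex.exp P) * theta ((Complex.exp q)⁻¹ * (Complex.exp j)⁻¹ * Complex.exp l) (Complex.exp P) /
      (theta (Complex.exp u * (Complex.exp q)⁻¹ * (Complex.exp a)⁻¹ * Complex.exp j) (Complex.exp P) * theta (Complex.exp u * (Complex.exp q)⁻¹ * (Complex.exp j)⁻¹ * Complex.exp l) (Complex.exp P) * theta (Complex.exp a * (Complex.exp j)⁻¹) (Complex.exp P) * theta (Complex.exp j * (Complex.exp l)⁻¹) (Complex.exp P))) := by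
  refine quot8
    (theta_shiftE P ((1) * u + (1) * a + (-1) * j) _ _ hP ((1) * ku + (1) * ka + (-1) * kj) ?_ ?_)
    (theta_shiftE P ((1) * u + (1) * j + (-1) * l) _ _ hP ((1) * ku + (1) * kj + (-1) * kl) ?_ ?_)
    (theta_shiftE P ((-1) * q + (-1) * a + (1) * j) _ _ hP ((-1) * kq + (-1) * ka + (1) * kj) ?_ ?_)
    (theta_shiftE P ((-1) * q + (-1) * j + (1) * l) _ _ hP ((-1) * kq + (-1) * kj + (1) * kl) ?_ ?_)
    (theta_shiftE P ((1) * u + (-1) * q + (-1) * a + (1) * j) _ _ hP ((1) * ku + (-1) * kq + (-1) * ka + (1) * kj) ?_ ?_)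
    (theta_shiftE P ((1) * u + (-1) * q + (-1) * j + (1) * l) _ _ hP ((1) * ku + (-1) * kq + (-1) * kj + (1) * kl) ?_ ?_)
    (theta_shiftE P ((1) * a + (-1) * j) _ _ hP ((1) * ka + (-1) * kj) ?_ ?_)
    (theta_shiftE P ((1) * j + (-1) * l) _ _ hP ((1) * kj + (-1) * kl) ?_ ?_)
    ?_
  all_goals first
    | (simp only [← Complex.exp_neg, ← Complex.exp_add, ← Complex.exp_nat_mul, neg_neg, neg_mul,
        mul_neg, inv_neg]; congr 1; push_cast; ring)
    | (push_cast; ring)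

lemma fac_m (P u q a l : ℂ) (hP : ‖Complex.exp P‖ < 1) (ku kq ka kl : ℤ) :
    theta (Complex.exp (u + ku * P) * Complex.exp (q + kq * P) * Complex.exp (a + ka * P) * (Complex.exp (l + kl * P))⁻¹) (Complex.exp P) * theta (Complex.exp (u + ku * P) * Complex.exp (a + ka * P) * (Complex.exp (l + kl * P))⁻¹) (Complex.exp P) * theta ((Complex.exp (q + kq * P))⁻¹ ^ 2 * (Complex.exp (a + ka * P))⁻¹ * Complex.exp (l + kl * P)) (Complex.exp P) * theta ((Complex.exp (q + kq * P))⁻¹ * (Complex.exp (a + ka * P))⁻¹ * Complex.exp (l + kl * P)) (Complex.exp P) /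
      (theta (Complex.exp (u + ku * P) * (Complex.exp (q + kq * P))⁻¹ * (Complex.exp (a + ka * P))⁻¹ * Complex.exp (l + kl * P)) (Complex.exp P) * theta (Complex.exp (u + ku * P) * (Complex.exp (q + kq * P))⁻¹ ^ 2 * (Complex.exp (a + ka * P))⁻¹ * Complex.exp (l + kl * P)) (Complex.exp P) * theta (Complex.exp (q + kq * P) * Complex.exp (a + ka * P) * (Complex.exp (l + kl * P))⁻¹) (Complex.exp P) * theta (Complex.exp (a + ka * P) * (Complex.exp (l + kl * P))⁻¹) (Complex.exp P)) =
    Complex.exp (-4 * ((kq + ka - kl) * u + (q + a - l) * ku + (kq + ka - kl) * ku * P)) *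
      (theta (Complex.exp u * Complex.exp q * Complex.exp a * (Complex.exp l)⁻¹) (Complex.exp P) * theta (Complex.exp u * Complex.exp a * (Complex.exp l)⁻¹) (Complex.exp P) * theta ((Complex.exp q)⁻¹ ^ 2 * (Complex.exp a)⁻¹ * Complex.exp l) (Complex.exp P) * theta ((Complex.exp q)⁻¹ * (Complex.exp a)⁻¹ * Complex.exp l) (Complex.exp P) /
      (theta (Complex.exp u * (Complex.exp q)⁻¹ * (Complex.exp a)⁻¹ * Complex.exp l) (Complex.exp P) * theta (Complex.exp u * (Complex.exp q)⁻¹ ^ 2 * (Complex.exp a)⁻¹ * Complex.exp l) (Complex.exp P) * theta (Complex.exp q * Complex.exp a * (Complex.exp l)⁻¹) (Complex.exp P) * theta (Complex.exp a * (Complex.exp l)⁻¹) (Complex.exp P))) := by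
  refine quot8
    (theta_shiftE P ((1) * u + (1) * q + (1) * a + (-1) * l) _ _ hP ((1) * ku + (1) * kq + (1) * ka + (-1) * kl) ?_ ?_)
    (theta_shiftE P ((1) * u + (1) * a + (-1) * l) _ _ hP ((1) * ku + (1) * ka + (-1) * kl) ?_ ?_)
    (theta_shiftE P ((-2) * q + (-1) * a + (1) * l) _ _ hP ((-2) * kq + (-1) * ka + (1) * kl) ?_ ?_)
    (theta_shiftE P ((-1) * q + (-1) * a + (1) * l) _ _ hP ((-1) * kq + (-1) * ka + (1) * kl) ?_ ?_)
    (theta_shiftE P ((1) * u + (-1) * q + (-1) * a + (1) * l) _ _ hP ((1) * ku + (-1) * kq + (-1) * ka + (1) * kl) ?_ ?_)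
    (theta_shiftE P ((1) * u + (-2) * q + (-1) * a + (1) * l) _ _ hP ((1) * ku + (-2) * kq + (-1) * ka + (1) * kl) ?_ ?_)
    (theta_shiftE P ((1) * q + (1) * a + (-1) * l) _ _ hP ((1) * kq + (1) * ka + (-1) * kl) ?_ ?_)
    (theta_shiftE P ((1) * a + (-1) * l) _ _ hP ((1) * ka + (-1) * kl) ?_ ?_)
    ?_
  all_goals first
    | (simp only [← Complex.exp_neg, ← Complex.exp_add, ← Complex.exp_nat_mul, neg_neg, neg_mul,
        mul_neg, inv_neg]; congr 1; push_cast; ring)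
    | (push_cast; ring)

lemma fac_f (P q a l s t : ℂ) (hP : ‖Complex.exp P‖ < 1) (kq ka kl ks kt : ℤ) :
    theta ((-Complex.exp (s + ks * P)) * Complex.exp (a + ka * P)) (Complex.exp P) * theta (((-Complex.exp (t + kt * P)))⁻¹ * (Complex.exp (l + kl * P))⁻¹) (Complex.exp P) /
      (theta ((Complex.exp (q + kq * P))⁻¹ * (-Complex.exp (s + ks * P)) * Complex.exp (l + kl * P)) (Complex.exp P) * theta ((Complex.exp (q + kq * P))⁻¹ * ((-Complex.exp (t + kt * P)))⁻¹ * (Complex.exp (a + ka * P))⁻¹) (Complex.exp P)) =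
    Complex.exp (-((kq + ka - kl) * (s - t - q - P) + (q + a - l) * (ks - kt - kq) + (kq + ka - kl) * (ks - kt - kq) * P)) *
      (theta ((-Complex.exp s) * Complex.exp a) (Complex.exp P) * theta (((-Complex.exp t))⁻¹ * (Complex.exp l)⁻¹) (Complex.exp P) /
      (theta ((Complex.exp q)⁻¹ * (-Complex.exp s) * Complex.exp l) (Complex.exp P) * theta ((Complex.exp q)⁻¹ * ((-Complex.exp t))⁻¹ * (Complex.exp a)⁻¹) (Complex.exp P))) := by
  refine quot4
    (theta_shiftN P ((1) * s + (1) * a) _ _ hP ((1) * ks + (1) * ka) ?_ ?_)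
    (theta_shiftN P ((-1) * t + (-1) * l) _ _ hP ((-1) * kt + (-1) * kl) ?_ ?_)
    (theta_shiftN P ((-1) * q + (1) * s + (1) * l) _ _ hP ((-1) * kq + (1) * ks + (1) * kl) ?_ ?_)
    (theta_shiftN P ((-1) * q + (-1) * t + (-1) * a) _ _ hP ((-1) * kq + (-1) * kt + (-1) * ka) ?_ ?_)
    ?_
  all_goals first
    | (simp only [← Complex.exp_neg, ← Complex.exp_add, ← Complex.exp_nat_mul, neg_neg, neg_mul,
        mul_neg, inv_neg]; congr 1; push_cast; ring)
    | (push_cast; ring)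

/-- Any integer shift of all the (logarithmic) variables that preserves the balancing condition
leaves the certificate invariant. -/
lemma cert_exp (n f : ℕ) (P Q u : ℂ) (hP : ‖Complex.exp P‖ < 1) (ζ : Fin (n + 1) → ℂ)
    (σ τ : Fin (f + 1) → ℂ) (kq ku : ℤ) (m : Fin (n + 1) → ℤ) (c d : Fin (f + 1) → ℤ)
    (a : Fin n) (r : ℤ)
    (hB : 2 * (n + 1) * u + ∑ i, σ i - ∑ i, τ i - (f + 1) * (Q + P) =
      r * (2 * Real.pi * Complex.I))
    (hk : 2 * (n + 1) * ku + ∑ i, c i - ∑ i, d i = (f + 1) * kq) :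
    ksCert n f (Complex.exp P) (Complex.exp (Q + kq * P)) (Complex.exp (u + ku * P))
      (fun j => Complex.exp (ζ j + m j * P)) (fun i => -Complex.exp (σ i + c i * P))
      (fun i => -Complex.exp (τ i + d i * P)) a =
    ksCert n f (Complex.exp P) (Complex.exp Q) (Complex.exp u)
      (fun j => Complex.exp (ζ j)) (fun i => -Complex.exp (σ i))
      (fun i => -Complex.exp (τ i)) a := by
  unfold ksCert
  simp only [fac_j P _ _ _ _ _ hP, fac_m P _ _ _ _ hP, fac_f P _ _ _ _ _ hP]
  simp only [Finset.prod_mul_distrib, ← Complex.exp_sum]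
  have hcard : ((Finset.univ.filter (fun j : Fin n => j ≠ a)).card : ℂ) = n - 1 := by
    rw [Finset.filter_ne' Finset.univ a, Finset.card_erase_of_mem (Finset.mem_univ a)]
    have : 1 ≤ n := by have := a.2; omega
    simp [Nat.cast_sub this]
  have hk' : 2 * ((n : ℂ) + 1) * ku + ∑ i, (c i : ℂ) - ∑ i, (d i : ℂ) = (f + 1) * kq := by
    exact_mod_cast hk
  have key : ∀ X Y Z A B C : ℂ, X + Y + Z = ((-(kq + m a.castSucc - m (Fin.last n)) * r : ℤ) : ℂ) *
      (2 * Real.pi * Complex.I) →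
      (Complex.exp X * A) * (Complex.exp Y * B) * (Complex.exp Z * C) = A * B * C := by
    intro X Y Z A B C h
    have h1 : Complex.exp X * Complex.exp Y * Complex.exp Z = 1 := by
      rw [← Complex.exp_add, ← Complex.exp_add, h, Complex.exp_int_mul_two_pi_mul_I]
    linear_combination A * B * C * h1
  apply key
  simp only [Finset.sum_const, nsmul_eq_mul, hcard, Finset.sum_neg_distrib, Finset.sum_add_distrib,
    Finset.sum_sub_distrib, ← Finset.mul_sum, ← Finset.sum_mul, Finset.card_univ,
    Fintype.card_fin]
  push_cast
  set k : ℂ := kq + m a.castSucc - m (Fin.last n)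
  linear_combination (-k) * hB - (Q + ζ a.castSucc - ζ (Fin.last n) + k * P) * hk'

lemma cert_shift (n f : ℕ) (p q U : ℂ) (hp0 : p ≠ 0) (hp1 : ‖p‖ < 1) (hq : q ≠ 0) (hU : U ≠ 0)
    (z : Fin (n + 1) → ℂ) (hz : ∀ j, z j ≠ 0)
    (s t : Fin (f + 1) → ℂ) (hs : ∀ i, s i ≠ 0) (ht : ∀ i, t i ≠ 0)
    (hbal : U ^ (2 * (n + 1)) * (∏ i, s i) * (∏ i, t i)⁻¹ = (p * q) ^ (f + 1))
    (a : Fin n) (kq ku : ℤ) (m : Fin (n + 1) → ℤ) (c d : Fin (f + 1) → ℤ)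
    (hk : 2 * (n + 1) * ku + ∑ i, c i - ∑ i, d i = (f + 1) * kq) :
    ksCert n f p (p ^ kq * q) (p ^ ku * U) (fun j => p ^ m j * z j) (fun i => p ^ c i * s i)
      (fun i => p ^ d i * t i) a = ksCert n f p q U z s t a := by
  obtain ⟨P, rfl⟩ : ∃ P, Complex.exp P = p := ⟨_, Complex.exp_log hp0⟩
  obtain ⟨Q, rfl⟩ : ∃ P, Complex.exp P = q := ⟨_, Complex.exp_log hq⟩
  obtain ⟨u, rfl⟩ : ∃ P, Complex.exp P = U := ⟨_, Complex.exp_log hU⟩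
  obtain ⟨ζ, rfl⟩ : ∃ ζ : Fin (n + 1) → ℂ, (fun j => Complex.exp (ζ j)) = z :=
    ⟨fun j => Complex.log (z j), funext fun j => Complex.exp_log (hz j)⟩
  obtain ⟨σ, rfl⟩ : ∃ σ : Fin (f + 1) → ℂ, (fun j => -Complex.exp (σ j)) = s :=
    ⟨fun j => Complex.log (-s j), funext fun j => by
      rw [Complex.exp_log (neg_ne_zero.mpr (hs j)), neg_neg]⟩
  obtain ⟨τ, rfl⟩ : ∃ σ : Fin (f + 1) → ℂ, (fun j => -Complex.exp (σ j)) = t :=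
    ⟨fun j => Complex.log (-t j), funext fun j => by
      rw [Complex.exp_log (neg_ne_zero.mpr (ht j)), neg_neg]⟩
  have h1 : Complex.exp (2 * (n + 1) * u + ∑ i, σ i - ∑ i, τ i - (f + 1) * (Q + P)) = 1 := by
    have hS : ∀ σ : Fin (f + 1) → ℂ, ∏ i, -Complex.exp (σ i) =
        (-1) ^ (f + 1) * Complex.exp (∑ i, σ i) := by
      intro σ
      rw [Finset.prod_neg, Complex.exp_sum]
      simp
    simp only [hS] at hbal
    rw [← Complex.exp_add, ← Complex.exp_nat_mul, ← Complex.exp_nat_mul] at hbal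
    push_cast at hbal
    rw [Complex.exp_sub, Complex.exp_sub, Complex.exp_add, div_eq_one_iff_eq (Complex.exp_ne_zero _),
      add_comm Q P, ← hbal, mul_inv]
    have : ((-1 : ℂ) ^ (f + 1)) ≠ 0 := pow_ne_zero _ (by norm_num)
    field_simp
  obtain ⟨r, hr⟩ := Complex.exp_eq_one_iff.mp h1
  have := cert_exp n f P Q u hp1 ζ σ τ kq ku m c d a r hr hk
  rw [← this]
  have e : ∀ (k : ℤ) (x : ℂ), Complex.exp P ^ k * Complex.exp x = Complex.exp (x + k * P) := by
    intro k x
    rw [← Complex.exp_int_mul, ← Complex.exp_add, add_comm]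
  simp only [mul_neg, e]

lemma update_two {n : ℕ} (p : ℂ) (z : Fin (n + 1) → ℂ) (b : Fin n) :
    Function.update (Function.update z b.castSucc (p * z b.castSucc))
      (Fin.last n) (p⁻¹ * z (Fin.last n)) =
    fun j => p ^ ((if j = b.castSucc then (1 : ℤ) else 0) - (if j = Fin.last n then 1 else 0))
      * z j := by
  have hb : Fin.last n ≠ b.castSucc := (Fin.castSucc_lt_last b).ne'
  funext j
  by_cases h1 : j = Fin.last n
  · subst h1; simp [hb]
  · by_cases h2 : j = b.castSucc
    · subst h2; simp [hb.symm]
    · simp [h1, h2]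

lemma update_one {n : ℕ} (p : ℂ) (z : Fin (n + 1) → ℂ) (k : ℤ) :
    Function.update z (Fin.last n) (p ^ k * z (Fin.last n)) =
    fun j => p ^ (if j = Fin.last n then k else 0) * z j := by
  funext j
  by_cases h1 : j = Fin.last n
  · subst h1; simp
  · simp [h1]

/-- Total ellipticity of the `q`-certificates `h_a` for the Kutasov–Schwimmer
duality of `SU(N)` (`N = n+1 ≥ 2`) with `N_f = f+1` flavors and an adjoint:
the certificate is invariant under `p`-shifts of the `z`-, `s`- and
`t`-variables and under the shift `(q,U,t_{N_f}) → (p^{K+1}q, pU,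
p^{2N-(K+1)N_f} t_{N_f})`, wherever all denominator theta factors are
nonzero. -/
theorem ks_certificate_total_ellipticity (n f K : ℕ) (hn : 1 ≤ n) (hK : 1 ≤ K)
    (p q U : ℂ) (hp0 : p ≠ 0) (hp1 : ‖p‖ < 1) (hq : q ≠ 0) (hU : U ≠ 0)
    (z : Fin (n + 1) → ℂ) (hz : ∀ j, z j ≠ 0) (hzprod : ∏ j, z j = 1)
    (s t : Fin (f + 1) → ℂ) (hs : ∀ i, s i ≠ 0) (ht : ∀ i, t i ≠ 0)
    (hbal : U ^ (2 * (n + 1)) * (∏ i, s i) * (∏ i, t i)⁻¹ = (p * q) ^ (f + 1))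
    (a : Fin n) :
    (∀ b : Fin n,
        ksDen n f p q U z s t a ≠ 0 →
        ksDen n f p q U
            (Function.update (Function.update z b.castSucc (p * z b.castSucc))
              (Fin.last n) (p⁻¹ * z (Fin.last n))) s t a ≠ 0 →
        ksCert n f p q U
            (Function.update (Function.update z b.castSucc (p * z b.castSucc))
              (Fin.last n) (p⁻¹ * z (Fin.last n))) s t a =
          ksCert n f p q U z s t a) ∧
    (∀ b : Fin f,
        ksDen n f p q U z s t a ≠ 0 →
        ksDen n f p q U z
            (Function.update (Function.update s b.castSucc (p * s b.castSucc))
              (Fin.last f) (p⁻¹ * s (Fin.last f))) t a ≠ 0 →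
        ksCert n f p q U z
            (Function.update (Function.update s b.castSucc (p * s b.castSucc))
              (Fin.last f) (p⁻¹ * s (Fin.last f))) t a =
          ksCert n f p q U z s t a) ∧
    (∀ b : Fin f,
        ksDen n f p q U z s t a ≠ 0 →
        ksDen n f p q U z s
            (Function.update (Function.update t b.castSucc (p * t b.castSucc))
              (Fin.last f) (p⁻¹ * t (Fin.last f))) a ≠ 0 →
        ksCert n f p q U z s
            (Function.update (Function.update t b.castSucc (p * t b.castSucc))
              (Fin.last f) (p⁻¹ * t (Fin.last f))) a =
          ksCert n f p q U z s t a) ∧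
    (ksDen n f p q U z s t a ≠ 0 →
      ksDen n f p (p ^ (K + 1) * q) (p * U) z s
          (Function.update t (Fin.last f)
            (p ^ ((2 * (n + 1) : ℤ) - ((K : ℤ) + 1) * ((f : ℤ) + 1)) * t (Fin.last f))) a ≠ 0 →
      ksCert n f p (p ^ (K + 1) * q) (p * U) z s
          (Function.update t (Fin.last f)
            (p ^ ((2 * (n + 1) : ℤ) - ((K : ℤ) + 1) * ((f : ℤ) + 1)) * t (Fin.last f))) a =
        ksCert n f p q U z s t a) := by
  have main := cert_shift n f p q U hp0 hp1 hq hU z hz s t hs ht hbal a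
  refine ⟨fun b _ _ => ?_, fun b _ _ => ?_, fun b _ _ => ?_, fun _ _ => ?_⟩
  · rw [update_two]
    have := main 0 0 (fun j => (if j = b.castSucc then (1 : ℤ) else 0) -
      (if j = Fin.last n then 1 else 0)) (fun _ => 0) (fun _ => 0) (by simp)
    simpa using this
  · rw [update_two]
    have := main 0 0 (fun _ => 0) (fun j => (if j = b.castSucc then (1 : ℤ) else 0) -
      (if j = Fin.last f then 1 else 0)) (fun _ => 0) (by simp)
    simpa using this
  · rw [update_two]
    have := main 0 0 (fun _ => 0) (fun _ => 0) (fun j => (if j = b.castSucc then (1 : ℤ) else 0) -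
      (if j = Fin.last f then 1 else 0)) (by simp)
    simpa using this
  · rw [update_one]
    have := main (K + 1) 1 (fun _ => 0) (fun _ => 0) (fun j => if j = Fin.last f then
      ((2 * (n + 1) : ℤ) - ((K : ℤ) + 1) * ((f : ℤ) + 1)) else 0) (by simp; ring)
    rw [← this]
    have e : p ^ ((K : ℤ) + 1) = p ^ (K + 1) := by exact_mod_cast zpow_natCast p (K + 1)
    simp only [e, zpow_one, zpow_zero, one_mul]
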